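/- Suppose ‖∇log α₀(x)‖ ≤ L₀ for all x ∈ 𝒳 and the velocity field f satisfies ‖∇f(t,x)‖ ≤ L_f and ‖∇div f(t,x)‖ ≤ L_f for all t ∈ [0,T] and x ∈ 𝒳, with f(t,·) l-periodic. Then the score of the transported density ρ¹_t = X(t,·;f)♯α₀ satisfies, for every t ∈ [0,T] and x ∈ 𝒳, ‖∇log ρ¹_t(x)‖ ≤ (L₀ + t L_f) exp(t L_f) ≤ (L₀ + T L_f) exp(T L_f). -/

import Mathlib

open MeasureTheory Set

noncomputable section

abbrev E (d : ℕ) := EuclideanSpace ℝ (Fin d)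

def uvec (d : ℕ) (i : Fin d) : E d := EuclideanSpace.single i (1 : ℝ)

def box (d : ℕ) (l : ℝ) : Set (E d) := {x | ∀ i, x i ∈ Icc (-(l / 2)) (l / 2)}

def IsPeriodic {d : ℕ} {β : Type*} (l : ℝ) (g : E d → β) : Prop :=
  ∀ (x : E d) (i : Fin d), g (x + l • uvec d i) = g x

/-- Divergence of a vector field on `ℝ^d`. -/
def diverg {d : ℕ} (F : E d → E d) (x : E d) : ℝ :=
  ∑ i, fderiv ℝ F x (uvec d i) i

theorem exists_period_sub_mem_box {d : ℕ} {l : ℝ} (hl : 0 < l) (x : E d) :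
    ∃ c : E d, x - c ∈ box d l ∧
      ∀ {β : Type} (g : E d → β), IsPeriodic l g → ∀ y, g (y - c) = g y := by
  refine ⟨∑ i, round (x i / l) • (l • uvec d i), fun i => ?_, fun g hg y => ?_⟩
  · have hcoord : (x - ∑ j, round (x j / l) • (l • uvec d j)) i
        = x i - round (x i / l) * l := by
      simp [uvec, Pi.single_apply, mul_comm]
    rw [hcoord]
    have h := abs_sub_round (x i / l)
    have hmul : x i - round (x i / l) * l = (x i / l - round (x i / l)) * l := by
      field_simp
    rw [abs_le] at h
    rw [hmul]
    constructor <;> nlinarith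
  · have hper : Function.Periodic g (∑ i, round (x i / l) • (l • uvec d i)) :=
      Finset.sum_induction _ (fun c => Function.Periodic g c)
        (fun _ _ => Function.Periodic.add_period) (fun y => by simp)
        (fun i _ => Function.Periodic.zsmul (fun y => hg y i) _)
    exact hper.neg y ▸ by rw [sub_eq_add_neg]

theorem isCompact_box (d : ℕ) (l : ℝ) : IsCompact (box d l) := by
  have h : box d l =
      (EuclideanSpace.equiv (Fin d) ℝ).toHomeomorph ⁻¹'
        (univ.pi fun _ => Icc (-(l / 2)) (l / 2)) := by
    ext x
    simp only [box, mem_preimage, mem_univ_pi]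
    rfl
  rw [h, Homeomorph.isCompact_preimage]
  exact isCompact_univ_pi fun _ => isCompact_Icc

theorem IsPeriodic.fderiv {d : ℕ} {l : ℝ} {G : Type} [NormedAddCommGroup G] [NormedSpace ℝ G]
    {g : E d → G} (hg : IsPeriodic l g) : IsPeriodic l (fderiv ℝ g) := by
  intro x i
  rw [← fderiv_comp_add_right]
  congr 1
  exact funext fun y => hg y i

theorem IsPeriodic.le_of_le_on_box {d : ℕ} {l C : ℝ} (hl : 0 < l) {g : E d → ℝ}
    (hg : IsPeriodic l g) (h : ∀ x ∈ box d l, g x ≤ C) (x : E d) : g x ≤ C := by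
  obtain ⟨c, hc, hper⟩ := exists_period_sub_mem_box hl x
  exact hper g hg x ▸ h _ hc

theorem IsPeriodic.norm_sub_le {d : ℕ} {l C : ℝ} (hl : 0 < l) {G : Type} [NormedAddCommGroup G]
    [NormedSpace ℝ G] {g : E d → G} (hg : IsPeriodic l g) (hdiff : Differentiable ℝ g)
    (h : ∀ x ∈ box d l, ‖_root_.fderiv ℝ g x‖ ≤ C) (x y : E d) :
    ‖g x - g y‖ ≤ C * ‖x - y‖ :=
  convex_univ.norm_image_sub_le_of_norm_fderiv_le (fun z _ => hdiff z)
    (fun z _ => IsPeriodic.le_of_le_on_box hl (g := fun w => ‖_root_.fderiv ℝ g w‖)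
      (fun w i => by simp only [hg.fderiv w i]) h z)
    (mem_univ y) (mem_univ x)

theorem HasDerivAt.nonpos_of_eventually_le {φ : ℝ → ℝ} {c t : ℝ} (h : HasDerivAt φ c t)
    (hle : ∀ᶠ s in nhdsWithin 0 (Ioi 0), φ (t + s) ≤ φ t) : c ≤ 0 := by
  refine le_of_tendsto h.tendsto_slope_zero_right ?_
  filter_upwards [hle, self_mem_nhdsWithin] with s hs hpos
  have : 0 ≤ s⁻¹ := inv_nonneg.2 (le_of_lt hpos)
  exact mul_nonpos_of_nonneg_of_nonpos this (by linarith)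

/-- Forced transport equations `∂ₜ v = g - ∇v · F` on a time interval, where the spatially
periodic solution is only assumed separately differentiable and `F`, `g` are `L`-Lipschitz
in space. -/
structure IsTransported {d : ℕ} (l L : ℝ) (v : ℝ → E d → ℝ) (F : ℝ → E d → E d)
    (g : ℝ → E d → ℝ) (a b : ℝ) : Prop where
  diff : ∀ t ∈ Icc a b, Differentiable ℝ (v t)
  per : ∀ t ∈ Icc a b, IsPeriodic l (v t)
  eqn : ∀ t ∈ Icc a b, ∀ x, HasDerivAt (fun τ => v τ x) (g t x - fderiv ℝ (v t) x (F t x)) t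
  lipF : ∀ t ∈ Icc a b, ∀ x y, ‖F t x - F t y‖ ≤ L * ‖x - y‖
  lipg : ∀ t ∈ Icc a b, ∀ x y, |g t x - g t y| ≤ L * ‖x - y‖

namespace IsTransported

variable {d : ℕ} {l L : ℝ} {v : ℝ → E d → ℝ} {F : ℝ → E d → E d} {g : ℝ → E d → ℝ} {a b : ℝ}

theorem mono (h : IsTransported l L v F g a b) {s t : ℝ} (hs : a ≤ s) (ht : t ≤ b) :
    IsTransported l L v F g s t := by
  have hsub : Icc s t ⊆ Icc a b := Icc_subset_Icc hs ht
  exact ⟨fun r hr => h.diff r (hsub hr), fun r hr => h.per r (hsub hr),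
    fun r hr => h.eqn r (hsub hr), fun r hr => h.lipF r (hsub hr),
    fun r hr => h.lipg r (hsub hr)⟩

theorem reverse (h : IsTransported l L v F g a b) :
    IsTransported l L (fun t => v (-t)) (fun t x => -F (-t) x) (fun t x => -g (-t) x)
      (-b) (-a) := by
  have hmem : ∀ {t}, t ∈ Icc (-b) (-a) → -t ∈ Icc a b := fun ht =>
    ⟨by linarith [ht.2], by linarith [ht.1]⟩
  refine ⟨fun t ht => h.diff _ (hmem ht), fun t ht => h.per _ (hmem ht), fun t ht x => ?_,
    fun t ht x y => ?_, fun t ht x y => ?_⟩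
  · have hd := (h.eqn _ (hmem ht) x).scomp t (hasDerivAt_neg t)
    refine hd.congr_deriv ?_
    simp
    ring
  · rw [neg_sub_neg, norm_sub_rev]
    exact h.lipF _ (hmem ht) x y
  · rw [neg_sub_neg, abs_sub_comm]
    exact h.lipg _ (hmem ht) x y

/-- At a maximum point of the doubled function `v t x - v t y - A ‖x - y‖`, the transport
equation controls the growth of the difference. -/
theorem deriv_sub_le_of_isMax (h : IsTransported l L v F g a b) {A t : ℝ} (hA : 0 ≤ A)
    (ht : t ∈ Icc a b) {x₀ y₀ : E d}
    (hmax : ∀ x y, v t x - v t y - A * ‖x - y‖ ≤ v t x₀ - v t y₀ - A * ‖x₀ - y₀‖) :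
    (g t x₀ - fderiv ℝ (v t) x₀ (F t x₀)) - (g t y₀ - fderiv ℝ (v t) y₀ (F t y₀))
      ≤ L * (A + 1) * ‖x₀ - y₀‖ := by
  have hline : ∀ z : E d, HasDerivAt (fun s : ℝ => v t (z - s • F t z))
      (-(fderiv ℝ (v t) z (F t z))) 0 := by
    intro z
    have hz : HasDerivAt (fun s : ℝ => z - s • F t z) (-F t z) 0 := by
      simpa using ((hasDerivAt_id (0 : ℝ)).smul_const (F t z)).const_sub z
    have hv : HasFDerivAt (v t) (fderiv ℝ (v t) z) (z - (0 : ℝ) • F t z) := by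
      simpa using (h.diff t ht z).hasFDerivAt
    simpa using! hv.comp_hasDerivAt (0 : ℝ) hz
  have hφ : HasDerivAt
      (fun s : ℝ => v t (x₀ - s • F t x₀) - v t (y₀ - s • F t y₀) - s * (A * L * ‖x₀ - y₀‖))
      (-(fderiv ℝ (v t) x₀ (F t x₀)) - -(fderiv ℝ (v t) y₀ (F t y₀)) - A * L * ‖x₀ - y₀‖)
      0 := by
    refine (((hline x₀).sub (hline y₀)).sub
      ((hasDerivAt_id (0 : ℝ)).mul_const (A * L * ‖x₀ - y₀‖))).congr_deriv ?_
    rw [one_mul]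
  have hnonpos := hφ.nonpos_of_eventually_le (by
    filter_upwards [self_mem_nhdsWithin] with s hs
    have hs' : (0 : ℝ) < s := hs
    have hm := hmax (x₀ - s • F t x₀) (y₀ - s • F t y₀)
    have hnorm : ‖(x₀ - s • F t x₀) - (y₀ - s • F t y₀)‖
        ≤ ‖x₀ - y₀‖ + s * (L * ‖x₀ - y₀‖) := by
      have heq : (x₀ - s • F t x₀) - (y₀ - s • F t y₀)
          = (x₀ - y₀) - s • (F t x₀ - F t y₀) := by
        rw [smul_sub]; abel
      rw [heq]
      refine (norm_sub_le _ _).trans ?_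
      rw [norm_smul, Real.norm_of_nonneg hs'.le]
      have := h.lipF t ht x₀ y₀
      gcongr
    have := mul_le_mul_of_nonneg_left hnorm hA
    simp only [zero_add, zero_smul, sub_zero, zero_mul]
    linarith)
  have := (abs_le.1 (h.lipg t ht x₀ y₀)).2
  linarith

theorem sub_le_of_lt (h : IsTransported l L v F g a b) (hl : 0 < l) (hab : a ≤ b)
    {A₀ L' M : ℝ} (hL : 0 ≤ L) (hLL' : L < L') (hA₀ : 0 < A₀) (hM : 0 ≤ M)
    (hbdd : ∀ t ∈ Icc a b, ∀ x y, |v t x - v t y| ≤ M * ‖x - y‖)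
    (hinit : ∀ x y, v a x - v a y ≤ A₀ * ‖x - y‖) (x y : E d) :
    v b x - v b y ≤ ((A₀ + 1) * Real.exp (L' * (b - a)) - 1) * ‖x - y‖ := by
  set A : ℝ → ℝ := fun t => (A₀ + 1) * Real.exp (L' * (t - a)) - 1 with hAdef
  have hA_ge : ∀ t ∈ Icc a b, A₀ ≤ A t := fun t ht => by
    have h1 : 1 ≤ Real.exp (L' * (t - a)) :=
      Real.one_le_exp (mul_nonneg (hL.trans hLL'.le) (by linarith [ht.1]))
    simp only [hAdef]
    nlinarith
  have hA_deriv : ∀ t, HasDerivAt A (L' * (A t + 1)) t := fun t => by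
    have h1 : HasDerivAt (fun t : ℝ => L' * (t - a)) (L' * 1) t :=
      ((hasDerivAt_id t).sub_const a).const_mul L'
    refine ((h1.exp.const_mul (A₀ + 1)).sub_const 1).congr_deriv ?_
    simp only [hAdef]
    ring
  obtain ⟨r, hr⟩ := (isCompact_box d l).isBounded.exists_norm_le
  set R : ℝ := M * (r + r) / A₀ with hRdef
  let Ψ : ℝ × (E d × E d) → ℝ := fun p => v p.1 p.2.1 - v p.1 p.2.2 - A p.1 * ‖p.2.1 - p.2.2‖
  let K : Set (ℝ × (E d × E d)) :=
    Icc a b ×ˢ (Metric.closedBall 0 r ×ˢ Metric.closedBall 0 (r + R))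
  have hosc : ∀ t ∈ Icc a b, ∀ x y, v t x - v t y ≤ M * (r + r) := by
    intro t ht x y
    obtain ⟨c, hc, hcper⟩ := exists_period_sub_mem_box hl x
    obtain ⟨e, he, heper⟩ := exists_period_sub_mem_box hl y
    rw [← hcper (v t) (h.per t ht) x, ← heper (v t) (h.per t ht) y]
    refine (le_abs_self _).trans ((hbdd t ht _ _).trans ?_)
    have := (norm_sub_le (x - c) (y - e)).trans (add_le_add (hr _ hc) (hr _ he))
    gcongr
  have hred : ∀ t ∈ Icc a b, ∀ x y, 0 < Ψ (t, x, y) → ∃ x' y', (t, x', y') ∈ K ∧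
      Ψ (t, x', y') = Ψ (t, x, y) := by
    intro t ht x y hpos
    obtain ⟨c, hc, hcper⟩ := exists_period_sub_mem_box hl x
    refine ⟨x - c, y - c, ⟨ht, ?_, ?_⟩, ?_⟩
    · simpa using hr _ hc
    · have hxy : ‖x - y‖ ≤ R := by
        rw [hRdef, le_div_iff₀ hA₀]
        have h1 := hosc t ht x y
        have h2 := mul_le_mul_of_nonneg_right (hA_ge t ht) (norm_nonneg (x - y))
        simp only [Ψ] at hpos
        linarith
      have heq : y - c = (x - c) - (x - y) := by abel
      simp only [mem_closedBall_zero_iff]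
      rw [heq]
      exact (norm_sub_le _ _).trans (add_le_add (hr _ hc) hxy)
    · simp only [Ψ, hcper (v t) (h.per t ht), sub_sub_sub_cancel_right]
  have hvcont : ContinuousOn (fun p : ℝ × E d => v p.1 p.2) (Icc a b ×ˢ univ) :=
    continuousOn_prod_of_continuousOn_lipschitzOnWith' (fun p : ℝ × E d => v p.1 p.2)
      ⟨M, hM⟩
      (fun t ht => LipschitzOnWith.of_dist_le_mul fun x _ y _ => by
        rw [Real.dist_eq, dist_eq_norm]; exact hbdd t ht x y)
      (fun x _ t ht => (h.eqn t ht x).continuousAt.continuousWithinAt)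
  have hAcont : Continuous A := by fun_prop
  have hΨcont : ContinuousOn Ψ K := by
    refine ContinuousOn.sub (ContinuousOn.sub ?_ ?_) ?_
    · exact hvcont.comp (f := fun p : ℝ × (E d × E d) => (p.1, p.2.1)) (by fun_prop)
        fun p hp => ⟨hp.1, mem_univ _⟩
    · exact hvcont.comp (f := fun p : ℝ × (E d × E d) => (p.1, p.2.2)) (by fun_prop)
        fun p hp => ⟨hp.1, mem_univ _⟩
    · exact Continuous.continuousOn (by fun_prop)
  have hKc : IsCompact K :=
    isCompact_Icc.prod ((isCompact_closedBall _ _).prod (isCompact_closedBall _ _))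
  by_contra! hcon
  have hb : b ∈ Icc a b := right_mem_Icc.2 hab
  have hpos : 0 < Ψ (b, x, y) := sub_pos.2 hcon
  obtain ⟨x₁, y₁, hK₁, heq₁⟩ := hred b hb x y hpos
  obtain ⟨⟨t₀, x₀, y₀⟩, hK₀, hmax₀⟩ := hKc.exists_isMaxOn ⟨_, hK₁⟩ hΨcont
  have ht₀ : t₀ ∈ Icc a b := hK₀.1
  have hpos₀ : 0 < Ψ (t₀, x₀, y₀) := by
    have := hmax₀ hK₁
    simp only [mem_ofPred_eq] at this
    linarith
  have hmax : ∀ t ∈ Icc a b, ∀ x y, Ψ (t, x, y) ≤ Ψ (t₀, x₀, y₀) := by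
    intro t ht x y
    rcases le_or_gt (Ψ (t, x, y)) 0 with h0 | h0
    · linarith
    · obtain ⟨x', y', hK', heq'⟩ := hred t ht x y h0
      rw [← heq']
      exact hmax₀ hK'
  have hat₀ : a < t₀ := by
    refine lt_of_le_of_ne ht₀.1 fun hat => ?_
    subst hat
    have := hinit x₀ y₀
    simp only [Ψ, hAdef, sub_self, mul_zero, Real.exp_zero] at hpos₀
    linarith
  have hne : 0 < ‖x₀ - y₀‖ := by
    refine norm_pos_iff.2 fun h0 => ?_
    rw [sub_eq_zero] at h0
    subst h0
    simp [Ψ] at hpos₀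
  have hspace := h.deriv_sub_le_of_isMax (hA₀.le.trans (hA_ge t₀ ht₀)) ht₀
    (fun x y => hmax t₀ ht₀ x y)
  have htime : HasDerivAt (fun τ => Ψ (τ, x₀, y₀))
      ((g t₀ x₀ - fderiv ℝ (v t₀) x₀ (F t₀ x₀)) - (g t₀ y₀ - fderiv ℝ (v t₀) y₀ (F t₀ y₀))
        - L' * (A t₀ + 1) * ‖x₀ - y₀‖) t₀ :=
    ((h.eqn t₀ ht₀ x₀).sub (h.eqn t₀ ht₀ y₀)).sub ((hA_deriv t₀).mul_const ‖x₀ - y₀‖)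
  have hback : HasDerivAt (fun τ => Ψ (-τ, x₀, y₀))
      (-((g t₀ x₀ - fderiv ℝ (v t₀) x₀ (F t₀ x₀)) - (g t₀ y₀ - fderiv ℝ (v t₀) y₀ (F t₀ y₀))
        - L' * (A t₀ + 1) * ‖x₀ - y₀‖)) (-t₀) := by
    refine (htime.scomp_of_eq (-t₀) (hasDerivAt_neg (-t₀)) (neg_neg t₀).symm).congr_deriv ?_
    rw [neg_one_smul]
  have hnonpos := hback.nonpos_of_eventually_le (by
    filter_upwards [Ioo_mem_nhdsGT (sub_pos.2 hat₀)] with s hs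
    rw [neg_neg]
    exact hmax _ ⟨by linarith [hs.2], by linarith [hs.1, ht₀.2]⟩ _ _)
  have hApos : 0 < A t₀ + 1 := by linarith [hA_ge t₀ ht₀]
  have := mul_lt_mul_of_pos_right hLL' (mul_pos hApos hne)
  linarith

theorem sub_le (h : IsTransported l L v F g a b) (hl : 0 < l) (hab : a ≤ b)
    {A₀ M : ℝ} (hL : 0 ≤ L) (hA₀ : 0 ≤ A₀) (hM : 0 ≤ M)
    (hbdd : ∀ t ∈ Icc a b, ∀ x y, |v t x - v t y| ≤ M * ‖x - y‖)
    (hinit : ∀ x y, v a x - v a y ≤ A₀ * ‖x - y‖) (x y : E d) :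
    v b x - v b y ≤ ((A₀ + 1) * Real.exp (L * (b - a)) - 1) * ‖x - y‖ := by
  have hlim : Filter.Tendsto
      (fun ε : ℝ => ((A₀ + ε + 1) * Real.exp ((L + ε) * (b - a)) - 1) * ‖x - y‖)
      (nhdsWithin 0 (Ioi 0)) (nhds (((A₀ + 1) * Real.exp (L * (b - a)) - 1) * ‖x - y‖)) := by
    have hc : Continuous
        (fun ε : ℝ => ((A₀ + ε + 1) * Real.exp ((L + ε) * (b - a)) - 1) * ‖x - y‖) := by
      fun_prop
    simpa using (hc.tendsto 0).mono_left nhdsWithin_le_nhds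
  refine ge_of_tendsto hlim ?_
  filter_upwards [self_mem_nhdsWithin] with ε hε
  have hε' : (0 : ℝ) < ε := hε
  exact h.sub_le_of_lt hl hab hL (by linarith) (by linarith) hM hbdd
    (fun x y => (hinit x y).trans (by gcongr; linarith)) x y

theorem abs_sub_le (h : IsTransported l L v F g a b) (hl : 0 < l) {s t : ℝ}
    (hs : s ∈ Icc a b) (ht : t ∈ Icc a b) {A₀ M : ℝ} (hL : 0 ≤ L) (hA₀ : 0 ≤ A₀) (hM : 0 ≤ M)
    (hbdd : ∀ r ∈ uIcc s t, ∀ x y, |v r x - v r y| ≤ M * ‖x - y‖)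
    (hinit : ∀ x y, |v s x - v s y| ≤ A₀ * ‖x - y‖) (x y : E d) :
    |v t x - v t y| ≤ ((A₀ + 1) * Real.exp (L * |t - s|) - 1) * ‖x - y‖ := by
  have key : ∀ x y, v t x - v t y ≤ ((A₀ + 1) * Real.exp (L * |t - s|) - 1) * ‖x - y‖ := by
    intro x y
    rcases le_total s t with hst | hst
    · rw [uIcc_of_le hst] at hbdd
      rw [abs_of_nonneg (sub_nonneg.2 hst)]
      exact (h.mono hs.1 ht.2).sub_le hl hst hL hA₀ hM hbdd
        (fun x y => (le_abs_self _).trans (hinit x y)) x y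
    · rw [uIcc_of_ge hst] at hbdd
      have hrev := (h.mono ht.1 hs.2).reverse.sub_le hl (neg_le_neg hst) hL hA₀ hM
        (fun r hr => hbdd (-r) ⟨by linarith [hr.2], by linarith [hr.1]⟩)
        (fun x y => by simpa using (le_abs_self _).trans (hinit x y)) x y
      rw [abs_sub_comm, abs_of_nonneg (sub_nonneg.2 hst)]
      simpa [neg_add_eq_sub] using hrev
  refine abs_le'.2 ⟨key x y, ?_⟩
  rw [neg_sub, norm_sub_rev]
  exact key y x

end IsTransported

/-- A countable closed cover of an interval along which membership propagates through any
segment contained in a single member reduces to a single member. -/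
theorem exists_Icc_subset_of_propagation {S : ℕ → Set ℝ} (hmono : Monotone S)
    (hclosed : ∀ n, IsClosed (S n)) {a b : ℝ} (hcover : Icc a b ⊆ ⋃ n, S n) (Φ : ℕ → ℕ)
    (hprop : ∀ n, ∀ s ∈ Icc a b, ∀ t ∈ Icc a b, (∃ m, uIcc s t ⊆ S m) → s ∈ S n → t ∈ S (Φ n)) :
    ∃ m, Icc a b ⊆ S m := by
  let good : Set ℝ := {t | ∃ U, IsOpen U ∧ t ∈ U ∧ ∃ n, U ∩ Icc a b ⊆ S n}
  have hgood_open : IsOpen good := by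
    refine isOpen_iff_forall_mem_open.2 fun t ⟨U, hU, htU, n, hn⟩ => ?_
    exact ⟨U, fun s hs => ⟨U, hU, hs, n, hn⟩, hU, htU⟩
  have hcompact : ∀ C : Set ℝ, IsCompact C → C ⊆ Icc a b → C ⊆ good → ∃ m, C ⊆ S m := by
    intro C hC hCab hCgood
    refine hC.induction_on (p := fun D => ∃ m, D ⊆ S m) ⟨0, empty_subset _⟩
      (fun D D' hDD' ⟨m, hm⟩ => ⟨m, hDD'.trans hm⟩) ?_ ?_
    · rintro D D' ⟨m, hm⟩ ⟨m', hm'⟩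
      exact ⟨max m m', union_subset (hm.trans (hmono (le_max_left _ _)))
        (hm'.trans (hmono (le_max_right _ _)))⟩
    · intro t ht
      obtain ⟨U, hU, htU, n, hn⟩ := hCgood ht
      exact ⟨U ∩ C, inter_comm C U ▸ inter_mem_nhdsWithin C (hU.mem_nhds htU), n,
        (inter_subset_inter_right _ hCab).trans hn⟩
  let B : Set ℝ := Icc a b \ good
  have hB_closed : IsClosed B := isClosed_Icc.sdiff hgood_open
  rcases B.eq_empty_or_nonempty with hB | hB
  · exact hcompact _ isCompact_Icc Subset.rfl (sdiff_eq_empty.1 hB)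
  exfalso
  have : Nonempty B := hB.to_subtype
  have : CompleteSpace B := hB_closed.completeSpace_coe
  obtain ⟨n, p, hp⟩ := nonempty_interior_of_iUnion_of_closed
    (f := fun n => ((↑) : B → ℝ) ⁻¹' S n) (fun n => (hclosed n).preimage continuous_subtype_val)
    (by
      rw [← preimage_iUnion]
      exact eq_univ_of_forall fun q => hcover q.2.1)
  obtain ⟨ε, hε, hball⟩ := Metric.mem_nhds_iff.1 (mem_interior_iff_mem_nhds.1 hp)
  refine p.2.2 ⟨Metric.ball p ε, Metric.isOpen_ball, Metric.mem_ball_self hε,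
    max n (Φ n), ?_⟩
  rintro t ⟨htball, ht⟩
  have hab' : ∀ {s r}, s ∈ Icc a b → r ∈ Icc a b → uIcc s r ⊆ Icc a b := fun hs hr =>
    ordConnected_Icc.uIcc_subset hs hr
  obtain ⟨q, ⟨hqseg, hqB⟩, hqmin⟩ := (isCompact_uIcc.inter_right hB_closed).exists_isMinOn
    (s := uIcc (p : ℝ) t ∩ B) ⟨p, left_mem_uIcc, p.2⟩
    (f := fun s => dist s t) (by fun_prop)
  have hqball : q ∈ Metric.ball (p : ℝ) ε := by
    rw [Metric.mem_ball, Real.dist_eq] at htball ⊢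
    exact (abs_sub_left_of_mem_uIcc hqseg).trans_lt htball
  have hqS : q ∈ S n := hball (show (⟨q, hqB⟩ : B) ∈ Metric.ball p ε from hqball)
  obtain ⟨k, hk⟩ := mem_iUnion.1 (hcover ht)
  have hseg : uIcc q t ⊆ S (max n (Φ k)) := by
    intro s hs
    rcases eq_or_ne s q with rfl | hsq
    · exact hmono (le_max_left _ _) hqS
    refine hmono (le_max_right _ _) (hprop k t ht s (hab' hqB.1 ht hs) ?_ hk)
    refine hcompact _ isCompact_uIcc (hab' ht (hab' hqB.1 ht hs)) fun r hr => ?_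
    by_contra hrgood
    have hrq : r ∈ uIcc q t := uIcc_subset_uIcc right_mem_uIcc hs hr
    have hrB : r ∈ B := ⟨hab' hqB.1 ht hrq, hrgood⟩
    have hle := hqmin ⟨uIcc_subset_uIcc hqseg right_mem_uIcc hrq, hrB⟩
    simp only [mem_ofPred_eq, Real.dist_eq] at hle
    apply hsq
    rcases le_total q t with hqt | hqt
    · rw [uIcc_of_le hqt] at hs
      rw [uIcc_of_ge hs.2] at hr
      rw [abs_of_nonpos (by linarith), abs_of_nonpos (by linarith [hr.2])] at hle
      linarith [hr.1, hs.1]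
    · rw [uIcc_of_ge hqt] at hs
      rw [uIcc_of_le hs.1] at hr
      rw [abs_of_nonneg (by linarith), abs_of_nonneg (by linarith [hr.1])] at hle
      linarith [hr.2, hs.2]
  exact hmono (le_max_right _ _) (hprop n q hqB.1 t ht ⟨_, hseg⟩ hqS)

/-- Baire category upgrades separate regularity of a transported function to a Lipschitz bound
that is uniform in time. -/
theorem IsTransported.exists_uniform_lipschitz {d : ℕ} {l L : ℝ} {v : ℝ → E d → ℝ}
    {F : ℝ → E d → E d} {g : ℝ → E d → ℝ} {a b : ℝ} (h : IsTransported l L v F g a b)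
    (hl : 0 < l) (hL : 0 ≤ L) (hsmooth : ∀ t ∈ Icc a b, ContDiff ℝ 1 (v t))
    (hcont : ∀ x, Continuous fun t => v t x) :
    ∃ m : ℕ, ∀ t ∈ Icc a b, ∀ x y, |v t x - v t y| ≤ m * ‖x - y‖ := by
  refine exists_Icc_subset_of_propagation
    (S := fun n : ℕ => {t | ∀ x y, |v t x - v t y| ≤ n * ‖x - y‖})
    (fun n m hnm t ht x y => (ht x y).trans (by gcongr)) (fun n => ?_) (fun t ht => ?_)
    (fun n => ⌈((n : ℝ) + 1) * Real.exp (L * (b - a)) - 1⌉₊) ?_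
  · simp only [ofPred_forall]
    exact isClosed_iInter fun x => isClosed_iInter fun y =>
      isClosed_le ((hcont x).sub (hcont y)).abs continuous_const
  · obtain ⟨C, hC⟩ := (isCompact_box d l).exists_bound_of_continuousOn
      ((hsmooth t ht).continuous_fderiv one_ne_zero).continuousOn
    obtain ⟨n, hn⟩ := exists_nat_ge C
    exact mem_iUnion.2 ⟨n, fun x y => ((h.per t ht).norm_sub_le hl (h.diff t ht) hC x y).trans
      (by gcongr)⟩
  · rintro n s hs t ht ⟨m, hm⟩ hsn x y
    refine (h.abs_sub_le hl hs ht hL n.cast_nonneg m.cast_nonneg (fun r hr => hm hr) hsn x y).trans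
      (mul_le_mul_of_nonneg_right (le_trans ?_ (Nat.le_ceil _)) (norm_nonneg _))
    have : |t - s| ≤ b - a := abs_sub_le_of_le_of_le ht.1 ht.2 hs.1 hs.2
    gcongr

theorem diverg_smul {d : ℕ} {r : E d → ℝ} {G : E d → E d} {x : E d}
    (hr : DifferentiableAt ℝ r x) (hG : DifferentiableAt ℝ G x) :
    diverg (fun y => r y • G y) x = r x * diverg G x + fderiv ℝ r x (G x) := by
  have hsum : G x = ∑ i, G x i • uvec d i := by
    simpa [uvec] using ((EuclideanSpace.basisFun (Fin d) ℝ).sum_repr (G x)).symm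
  have hf : fderiv ℝ r x (G x) = ∑ i, G x i * fderiv ℝ r x (uvec d i) := by
    conv_lhs => rw [hsum]
    simp [map_sum]
  rw [hf, diverg, diverg, Finset.mul_sum, ← Finset.sum_add_distrib, fderiv_fun_smul hr hG]
  refine Finset.sum_congr rfl fun i _ => ?_
  simp [mul_comm]

theorem contDiff_diverg {d : ℕ} {G : E d → E d} (hG : ContDiff ℝ (⊤ : ℕ∞) G) :
    ContDiff ℝ 1 (diverg G) := by
  have h1 : ContDiff ℝ 1 (fderiv ℝ G) := (hG.of_le (m := 2) (WithTop.coe_le_coe.2 le_top)).fderiv_right (by norm_num)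
  refine ContDiff.sum fun i _ => ?_
  exact (EuclideanSpace.proj (𝕜 := ℝ) i).contDiff.comp (h1.clm_apply contDiff_const)

theorem IsPeriodic.diverg {d : ℕ} {l : ℝ} {G : E d → E d} (hG : IsPeriodic l G) :
    IsPeriodic l (diverg G) := fun x i => by
  simp only [_root_.diverg, hG.fderiv x i]

theorem norm_gradient_eq_norm_fderiv {d : ℕ} (g : E d → ℝ) (x : E d) :
    ‖gradient g x‖ = ‖fderiv ℝ g x‖ :=
  (InnerProductSpace.toDual ℝ (E d)).symm.norm_map _

/-- The logarithm of a positive solution of the continuity equation is transported with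
forcing `-div f`. -/
theorem hasDerivAt_log_of_continuity {d : ℕ} {ρ : ℝ → E d → ℝ} {f : ℝ → E d → E d} {t : ℝ}
    {x : E d} (hρ : DifferentiableAt ℝ (ρ t) x) (hf : DifferentiableAt ℝ (f t) x)
    (hpos : 0 < ρ t x)
    (hCE : HasDerivAt (fun τ => ρ τ x) (-(diverg (fun y => ρ t y • f t y) x)) t) :
    HasDerivAt (fun τ => Real.log (ρ τ x))
      (-(diverg (f t) x) - fderiv ℝ (fun y => Real.log (ρ t y)) x (f t x)) t := by
  refine (hCE.log hpos.ne').congr_deriv ?_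
  rw [diverg_smul hρ hf, fderiv.log hρ hpos.ne']
  simp only [FunLike.coe_smul, Pi.smul_apply, smul_eq_mul]
  field_simp
  ring

/-- score bound: if `‖∇log α₀‖ ≤ L₀` on `𝒳` and
`‖∇f(t,·)‖, ‖∇div f(t,·)‖ ≤ L_f` on `𝒳` for all `t ∈ [0,T]`, with everything
`l`-periodic, then the score of the transported density `ρ_t` satisfies
`‖∇log ρ_t(x)‖ ≤ (L₀ + t L_f) exp(t L_f) ≤ (L₀ + T L_f) exp(T L_f)` on `[0,T] × 𝒳`. -/
theorem score_bound_transported_density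
    (d : ℕ) (l T L₀ Lf : ℝ) (hl : 0 < l) (hT : 0 < T) (hL₀ : 0 ≤ L₀) (hLf : 0 ≤ Lf)
    (f : ℝ → E d → E d) (K : NNReal)
    (hfsmooth : ∀ t, ContDiff ℝ (⊤ : ℕ∞) (f t))
    (hfcont : Continuous (Function.uncurry f))
    (hfLip : ∀ t, LipschitzWith K (f t))
    (hfper : ∀ t ∈ Icc (0 : ℝ) T, IsPeriodic l (f t))
    (hfbound : ∀ t ∈ Icc (0 : ℝ) T, ∀ x ∈ box d l,
      ‖fderiv ℝ (f t) x‖ ≤ Lf ∧ ‖gradient (fun y => diverg (f t) y) x‖ ≤ Lf)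
    (α₀ : E d → ℝ)
    (hα₀smooth : ContDiff ℝ (⊤ : ℕ∞) α₀) (hα₀pos : ∀ x, 0 < α₀ x)
    (hα₀per : IsPeriodic l α₀)
    (hα₀prob : ∫ x in box d l, α₀ x = 1)
    (hα₀bound : ∀ x ∈ box d l, ‖gradient (fun y => Real.log (α₀ y)) x‖ ≤ L₀)
    (ρ : ℝ → E d → ℝ)
    (hρsmooth : ∀ t, ContDiff ℝ (⊤ : ℕ∞) (ρ t)) (hρpos : ∀ t x, 0 < ρ t x)
    (hρper : ∀ t ∈ Icc (0 : ℝ) T, IsPeriodic l (ρ t))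
    (hρ0 : ρ 0 = α₀)
    (hCE : ∀ t x, HasDerivAt (fun τ => ρ τ x)
      (-(diverg (fun y => ρ t y • f t y) x)) t) :
    ∀ t ∈ Icc (0 : ℝ) T, ∀ x ∈ box d l,
      ‖gradient (fun y => Real.log (ρ t y)) x‖ ≤ (L₀ + t * Lf) * Real.exp (t * Lf) ∧
      (L₀ + t * Lf) * Real.exp (t * Lf) ≤ (L₀ + T * Lf) * Real.exp (T * Lf) := by
  intro t ht x _
  have hlog : ∀ t, ContDiff ℝ 1 (fun y => Real.log (ρ t y)) := fun t =>
    ((hρsmooth t).of_le (by exact_mod_cast le_top)).log fun y => (hρpos t y).ne'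
  have hρdiff : ∀ t, Differentiable ℝ (ρ t) := fun t => (hρsmooth t).differentiable (by simp)
  have hfdiff : ∀ t, Differentiable ℝ (f t) := fun t => (hfsmooth t).differentiable (by simp)
  have htr : IsTransported l Lf (fun t y => Real.log (ρ t y)) f (fun t y => -diverg (f t) y)
      0 T := by
    refine ⟨fun t _ => (hlog t).differentiable one_ne_zero,
      fun t ht x i => by simp only [hρper t ht x i],
      fun t _ x => hasDerivAt_log_of_continuity (hρdiff t x) (hfdiff t x) (hρpos t x) (hCE t x),
      fun t ht => (hfper t ht).norm_sub_le hl (hfdiff t) fun x hx => (hfbound t ht x hx).1,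
      fun t ht x y => ?_⟩
    rw [neg_sub_neg, abs_sub_comm]
    exact (hfper t ht).diverg.norm_sub_le hl
      ((contDiff_diverg (hfsmooth t)).differentiable one_ne_zero)
      (fun x hx => norm_gradient_eq_norm_fderiv (diverg (f t)) x ▸ (hfbound t ht x hx).2) x y
  obtain ⟨m, hm⟩ := htr.exists_uniform_lipschitz hl hLf (fun t _ => hlog t) fun x =>
    continuous_iff_continuousAt.2 fun t => ((hCE t x).log (hρpos t x).ne').continuousAt
  have h0 : (0 : ℝ) ∈ Icc 0 T := left_mem_Icc.2 hT.le
  have hinit : ∀ x y, |Real.log (ρ 0 x) - Real.log (ρ 0 y)| ≤ L₀ * ‖x - y‖ :=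
    (htr.per 0 h0).norm_sub_le hl (htr.diff 0 h0) fun x hx => by
      rw [← norm_gradient_eq_norm_fderiv, hρ0]
      exact hα₀bound x hx
  have hlip := htr.abs_sub_le hl h0 ht hLf hL₀ m.cast_nonneg
    (fun r hr => hm r (ordConnected_Icc.uIcc_subset h0 ht hr)) hinit
  rw [sub_zero, abs_of_nonneg ht.1] at hlip
  have hz : 0 ≤ t * Lf := mul_nonneg ht.1 hLf
  have hconst : (L₀ + 1) * Real.exp (Lf * t) - 1 ≤ (L₀ + t * Lf) * Real.exp (t * Lf) := by
    rw [mul_comm Lf t]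
    have h1 := Real.add_one_le_exp (-(t * Lf))
    have h2 : Real.exp (-(t * Lf)) * Real.exp (t * Lf) = 1 := by
      rw [← Real.exp_add, neg_add_cancel, Real.exp_zero]
    have h3 := mul_le_mul_of_nonneg_right h1 (Real.exp_pos (t * Lf)).le
    linarith
  constructor
  · rw [norm_gradient_eq_norm_fderiv]
    refine norm_fderiv_le_of_lip' ℝ (by positivity) (Filter.Eventually.of_forall fun y => ?_)
    exact (hlip y x).trans (mul_le_mul_of_nonneg_right hconst (norm_nonneg _))
  · have := ht.2
    gcongr
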